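/- Fix a real number t > 1. For each natural number n ≥ 1 put ξ_n = t·√(2n), σ_n = √(ξ_n² - 2n) = √(2n(t² - 1)), and Λ₂(n) = exp(n·ln(σ_n + ξ_n) + (ξ_n² - σ_n·ξ_n - n)/2) · √((1 + ξ_n/σ_n)/2). Then H_n(ξ_n)/Λ₂(n) → 1 as n → ∞, where H_n is the (physicists') Hermite polynomial. -/

import Mathlib

/-- The (physicists') Hermite polynomial
`H_n(x) = n! Σ_{k=0}^{⌊n/2⌋} (-1)^k / (k!(n-2k)!) (2x)^{n-2k}`. -/
noncomputable def hermite (n : ℕ) (x : ℝ) : ℝ :=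
  (n.factorial : ℝ) * ∑ k ∈ Finset.range (n / 2 + 1),
    (-1 : ℝ) ^ k / ((k.factorial : ℝ) * ((n - 2 * k).factorial : ℝ)) * (2 * x) ^ (n - 2 * k)

/-- The `k`-th term of the explicit Hermite sum, extended by zero. -/
noncomputable def hermiteTerm (n k : ℕ) (x : ℝ) : ℝ :=
  if 2 * k ≤ n then
    (n.factorial : ℝ) * ((-1 : ℝ) ^ k / ((k.factorial : ℝ) * ((n - 2 * k).factorial : ℝ)) *
      (2 * x) ^ (n - 2 * k))
  else 0

lemma hermite_eq_sum_hermiteTerm {n N : ℕ} (h : n / 2 + 1 ≤ N) (x : ℝ) :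
    hermite n x = ∑ k ∈ Finset.range N, hermiteTerm n k x := by
  rw [hermite, Finset.mul_sum]
  refine (Finset.sum_congr rfl fun k hk => ?_).trans
    (Finset.sum_subset (Finset.range_subset_range.2 h) fun k _ hk => ?_)
  · rw [hermiteTerm, if_pos (by rw [Finset.mem_range] at hk; omega)]
  · rw [hermiteTerm, if_neg (by rw [Finset.mem_range] at hk; omega)]

lemma hermiteTerm_add_two_zero (n : ℕ) (x : ℝ) :
    hermiteTerm (n + 2) 0 x = 2 * x * hermiteTerm (n + 1) 0 x := by
  have h1 : ((n + 1).factorial : ℝ) ≠ 0 := by positivity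
  have h2 : ((n + 2).factorial : ℝ) ≠ 0 := by positivity
  simp only [hermiteTerm, mul_zero, zero_le, if_true, Nat.sub_zero, Nat.factorial_zero,
    Nat.cast_one, pow_zero, one_mul]
  field_simp
  ring

lemma hermiteTerm_add_two_succ (n k : ℕ) (x : ℝ) :
    hermiteTerm (n + 2) (k + 1) x =
      2 * x * hermiteTerm (n + 1) (k + 1) x - 2 * (n + 1) * hermiteTerm n k x := by
  rcases lt_trichotomy n (2 * k) with h | h | h
  · simp only [hermiteTerm]
    rw [if_neg (by omega), if_neg (by omega), if_neg (by omega)]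
    ring
  · subst h
    simp only [hermiteTerm]
    rw [if_pos (by omega), if_neg (by omega), if_pos (by omega)]
    have h1 : 2 * k + 2 - 2 * (k + 1) = 0 := by omega
    simp only [h1, Nat.sub_self, Nat.factorial_succ]
    have := k.factorial_ne_zero
    push_cast
    field_simp
    ring
  · obtain ⟨m, rfl⟩ : ∃ m, n = 2 * k + (m + 1) := ⟨n - 2 * k - 1, by omega⟩
    simp only [hermiteTerm]
    rw [if_pos (by omega), if_pos (by omega), if_pos (by omega)]
    have h1 : 2 * k + (m + 1) + 2 - 2 * (k + 1) = m + 1 := by omega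
    have h2 : 2 * k + (m + 1) + 1 - 2 * (k + 1) = m := by omega
    have h3 : 2 * k + (m + 1) - 2 * k = m + 1 := by omega
    simp only [h1, h2, h3, Nat.factorial_succ]
    generalize (2 * k + (m + 1)).factorial = f
    have := k.factorial_ne_zero
    have := m.factorial_ne_zero
    push_cast
    field_simp
    ring

/-- The three-term recurrence of the Hermite polynomials. -/
lemma hermite_add_two (n : ℕ) (x : ℝ) :
    hermite (n + 2) x = 2 * x * hermite (n + 1) x - 2 * (n + 1) * hermite n x := by
  rw [hermite_eq_sum_hermiteTerm (n := n + 2) (N := n + 2 + 1) (by omega),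
    hermite_eq_sum_hermiteTerm (n := n + 1) (N := n + 2 + 1) (by omega),
    hermite_eq_sum_hermiteTerm (n := n) (N := n + 2) (by omega),
    Finset.sum_range_succ', Finset.sum_range_succ' (fun k => hermiteTerm (n + 1) k x),
    hermiteTerm_add_two_zero,
    Finset.sum_congr rfl fun k _ => hermiteTerm_add_two_succ n k x, Finset.sum_sub_distrib,
    ← Finset.mul_sum, ← Finset.mul_sum]
  ring

/-- The Gaussian integrand representing the Hermite polynomial at `a + v`, on the line of
imaginary shift `v`. -/
noncomputable def hermiteIntegrand (a v : ℝ) (n : ℕ) (y : ℝ) : ℂ :=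
  (2 * (a + y * Complex.I)) ^ n * Complex.exp (-(y + v * Complex.I) ^ 2)

lemma continuous_hermiteIntegrand (a v : ℝ) (n : ℕ) : Continuous (hermiteIntegrand a v n) := by
  unfold hermiteIntegrand
  fun_prop

lemma norm_exp_neg_sq_add_mul_I (v y : ℝ) :
    ‖Complex.exp (-(y + v * Complex.I) ^ 2)‖ = Real.exp (v ^ 2) * Real.exp (-y ^ 2) := by
  rw [Complex.norm_exp, ← Real.exp_add]
  congr 1
  simp [pow_two]
  ring

lemma norm_hermiteIntegrand_le (a v : ℝ) (n : ℕ) (y : ℝ) :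
    ‖hermiteIntegrand a v n y‖ ≤
      n.factorial * 2 ^ n * Real.exp (|a| + 1 / 2 + v ^ 2) * Real.exp (-(1 / 2) * y ^ 2) := by
  have h1 : ‖(a : ℂ) + y * Complex.I‖ ≤ |a| + |y| :=
    (norm_add_le _ _).trans (by simp)
  have h2 : (|a| + |y|) ^ n ≤ n.factorial * Real.exp (|a| + |y|) := by
    have := Real.pow_div_factorial_le_exp (|a| + |y|) (by positivity) n
    rwa [div_le_iff₀' (by positivity)] at this
  have h3 : Real.exp (|a| + |y|) ≤ Real.exp (|a| + 1 / 2 + 1 / 2 * y ^ 2) :=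
    Real.exp_le_exp.2 (by nlinarith [sq_nonneg (|y| - 1), sq_abs y])
  calc ‖hermiteIntegrand a v n y‖
      = 2 ^ n * ‖(a : ℂ) + y * Complex.I‖ ^ n * (Real.exp (v ^ 2) * Real.exp (-y ^ 2)) := by
        rw [hermiteIntegrand, norm_mul, norm_pow, norm_mul, norm_exp_neg_sq_add_mul_I, mul_pow]
        simp
    _ ≤ 2 ^ n * (n.factorial * Real.exp (|a| + 1 / 2 + 1 / 2 * y ^ 2)) *
          (Real.exp (v ^ 2) * Real.exp (-y ^ 2)) := by
        gcongr
        exact (pow_le_pow_left₀ (norm_nonneg _) h1 n).trans (h2.trans (by gcongr))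
    _ = n.factorial * 2 ^ n *
          (Real.exp (|a| + 1 / 2 + 1 / 2 * y ^ 2) * Real.exp (v ^ 2) * Real.exp (-y ^ 2)) := by
        ring
    _ = _ := by
        rw [mul_assoc (_ * _) (Real.exp _), ← Real.exp_add, ← Real.exp_add, ← Real.exp_add]
        ring_nf

lemma integrable_hermiteIntegrand (a v : ℝ) (n : ℕ) :
    MeasureTheory.Integrable (hermiteIntegrand a v n) :=
  ((integrable_exp_neg_mul_sq (b := 1 / 2) (by norm_num)).const_mul _).mono'
    (continuous_hermiteIntegrand a v n).aestronglyMeasurable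
    (Filter.Eventually.of_forall (norm_hermiteIntegrand_le a v n))

lemma hasDerivAt_two_mul_add_mul_I_pow (a : ℝ) (n : ℕ) (y : ℝ) :
    HasDerivAt (fun y : ℝ => (2 * ((a : ℂ) + y * Complex.I)) ^ n)
      (n * (2 * (a + y * Complex.I)) ^ (n - 1) * (2 * Complex.I)) y := by
  have h := ((((hasDerivAt_id (y : ℂ)).mul_const Complex.I).const_add (a : ℂ)).const_mul
    (2 : ℂ)).pow n
  simpa using h.comp_ofReal

lemma hasDerivAt_exp_neg_sq_add_mul_I (v y : ℝ) :
    HasDerivAt (fun y : ℝ => Complex.exp (-(y + v * Complex.I) ^ 2))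
      (-(2 * (y + v * Complex.I)) * Complex.exp (-(y + v * Complex.I) ^ 2)) y := by
  have h : HasDerivAt (fun z : ℂ => -(z + v * Complex.I) ^ 2) (-(2 * (y + v * Complex.I))) y := by
    simpa using (((hasDerivAt_id (y : ℂ)).add_const (v * Complex.I)).fun_pow 2).fun_neg
  simpa only [mul_comm] using h.cexp.comp_ofReal

lemma integral_hermiteIntegrand_zero (a v : ℝ) :
    ∫ y, hermiteIntegrand a v 0 y = (Real.sqrt Real.pi : ℂ) := by
  have h := GaussianFourier.integral_cexp_neg_mul_sq_add_real_mul_I (b := 1) (by simp) v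
  simp only [hermiteIntegrand, pow_zero, one_mul]
  simp only [neg_mul, one_mul, div_one] at h
  rw [h, Real.sqrt_eq_rpow, Complex.ofReal_cpow Real.pi_pos.le]
  simp

/-- Integration by parts, giving the recurrence for the Gaussian integrals. -/
lemma integral_hermiteIntegrand_succ (a v : ℝ) (n : ℕ) :
    ∫ y, hermiteIntegrand a v (n + 1) y =
      2 * (a + v) * (∫ y, hermiteIntegrand a v n y) -
        2 * n * ∫ y, hermiteIntegrand a v (n - 1) y := by
  have hu'v : (fun y : ℝ => (n * (2 * (a + y * Complex.I)) ^ (n - 1) * (2 * Complex.I)) *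
      Complex.exp (-(y + v * Complex.I) ^ 2)) =
      fun y => (2 * n * Complex.I) * hermiteIntegrand a v (n - 1) y := by
    ext y
    rw [hermiteIntegrand]
    ring
  have huv' : (fun y : ℝ => (2 * ((a : ℂ) + y * Complex.I)) ^ n *
      (-(2 * (y + v * Complex.I)) * Complex.exp (-(y + v * Complex.I) ^ 2))) =
      fun y => Complex.I * hermiteIntegrand a v (n + 1) y -
        (2 * (a + v) * Complex.I) * hermiteIntegrand a v n y := by
    ext y
    simp only [hermiteIntegrand, pow_succ _ n]
    linear_combination ((2 * ((a : ℂ) + y * Complex.I)) ^ n *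
      Complex.exp (-(y + v * Complex.I) ^ 2)) * (-2 * y) * Complex.I_sq
  have i1 := (integrable_hermiteIntegrand a v (n + 1)).const_mul Complex.I
  have i2 := (integrable_hermiteIntegrand a v n).const_mul (2 * (a + v) * Complex.I)
  have i3 := (integrable_hermiteIntegrand a v (n - 1)).const_mul (2 * n * Complex.I)
  have key := MeasureTheory.integral_mul_deriv_eq_deriv_mul_of_integrable
    (fun y _ => hasDerivAt_two_mul_add_mul_I_pow a n y)
    (fun y _ => hasDerivAt_exp_neg_sq_add_mul_I v y)
    ((i1.sub i2).congr (Filter.Eventually.of_forall fun y => (congrFun huv' y).symm))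
    (i3.congr (Filter.Eventually.of_forall fun y => (congrFun hu'v y).symm))
    (integrable_hermiteIntegrand a v n)
  rw [huv', hu'v, MeasureTheory.integral_sub i1 i2, MeasureTheory.integral_const_mul,
    MeasureTheory.integral_const_mul, MeasureTheory.integral_const_mul] at key
  apply mul_left_cancel₀ Complex.I_ne_zero
  linear_combination key

/-- The Gaussian integral representation of the Hermite polynomials. -/
lemma integral_hermiteIntegrand (a v : ℝ) (n : ℕ) :
    ∫ y, hermiteIntegrand a v n y = (Real.sqrt Real.pi * hermite n (a + v) : ℝ) := by
  induction n using Nat.twoStepInduction with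
  | zero => simp [integral_hermiteIntegrand_zero, hermite]
  | one =>
    rw [← zero_add 1, integral_hermiteIntegrand_succ, integral_hermiteIntegrand_zero]
    simp [hermite]
    ring_nf
  | more n ih0 ih1 =>
    rw [integral_hermiteIntegrand_succ, ih1, Nat.add_sub_cancel, ih0, hermite_add_two]
    push_cast
    ring

lemma norm_one_add_mul_exp_neg_sub_le {w : ℂ} (hw : ‖w‖ ≤ 1) :
    ‖(1 + w) * Complex.exp (-w) - 1 + w ^ 2 / 2‖ ≤ ‖w‖ ^ 3 := by
  have h := Complex.exp_bound (x := -w) (by simpa using hw) (n := 3) (by norm_num)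
  simp only [Finset.sum_range_succ, Finset.sum_range_zero, norm_neg, Nat.factorial] at h
  norm_num at h
  have h1 : (1 + w) * Complex.exp (-w) - 1 + w ^ 2 / 2 =
      (1 + w) * (Complex.exp (-w) - (1 + -w + w ^ 2 / 2)) + w ^ 3 / 2 := by ring
  have h2 : ‖1 + w‖ ≤ 2 := (norm_add_le _ _).trans (by norm_num; linarith)
  have h3 : (0 : ℝ) ≤ ‖w‖ ^ 3 := by positivity
  calc ‖(1 + w) * Complex.exp (-w) - 1 + w ^ 2 / 2‖
      ≤ ‖1 + w‖ * ‖Complex.exp (-w) - (1 + -w + w ^ 2 / 2)‖ + ‖w‖ ^ 3 / 2 := by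
        rw [h1]
        refine (norm_add_le _ _).trans_eq ?_
        simp
    _ ≤ 2 * (‖w‖ ^ 3 * (2 / 9)) + ‖w‖ ^ 3 / 2 := by gcongr
    _ ≤ ‖w‖ ^ 3 := by linarith

lemma tendsto_one_add_div_sqrt_mul_exp_neg_pow (z : ℂ) :
    Filter.Tendsto
      (fun n : ℕ => ((1 + z / (Real.sqrt n : ℝ)) * Complex.exp (-(z / (Real.sqrt n : ℝ)))) ^ n)
      Filter.atTop (nhds (Complex.exp (-z ^ 2 / 2))) := by
  have hsqrt : Filter.Tendsto (fun n : ℕ => Real.sqrt n) Filter.atTop Filter.atTop :=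
    Real.tendsto_sqrt_atTop.comp tendsto_natCast_atTop_atTop
  have hlim : Filter.Tendsto (fun n : ℕ => (n : ℂ) *
      ((1 + z / (Real.sqrt n : ℝ)) * Complex.exp (-(z / (Real.sqrt n : ℝ))) - 1))
      Filter.atTop (nhds (-z ^ 2 / 2)) := by
    rw [tendsto_iff_norm_sub_tendsto_zero]
    refine squeeze_zero' (Filter.Eventually.of_forall fun _ => norm_nonneg _) ?_
      (hsqrt.const_div_atTop (‖z‖ ^ 3))
    filter_upwards [hsqrt.eventually_ge_atTop ‖z‖, hsqrt.eventually_gt_atTop 0] with n hn hpos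
    set s := Real.sqrt n with hs
    have hsq : (n : ℝ) = s ^ 2 := (Real.sq_sqrt n.cast_nonneg).symm
    have hsqC : (n : ℂ) = (s : ℂ) ^ 2 := by exact_mod_cast congrArg Complex.ofReal hsq
    have hsC : (s : ℂ) ≠ 0 := by exact_mod_cast hpos.ne'
    have hnorm : ‖z / (s : ℂ)‖ = ‖z‖ / s := by
      rw [norm_div, Complex.norm_real, Real.norm_of_nonneg hpos.le]
    have hb := norm_one_add_mul_exp_neg_sub_le (w := z / (s : ℂ))
      (by rw [hnorm]; exact (div_le_one hpos).2 hn)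
    have heq : (n : ℂ) * ((1 + z / s) * Complex.exp (-(z / s)) - 1) - -z ^ 2 / 2 =
        (n : ℂ) * ((1 + z / s) * Complex.exp (-(z / s)) - 1 + (z / s) ^ 2 / 2) := by
      rw [hsqC]
      field_simp
      ring
    rw [heq, norm_mul, Complex.norm_natCast]
    refine (mul_le_mul_of_nonneg_left hb n.cast_nonneg).trans_eq ?_
    rw [hnorm, hsq]
    field_simp
  simpa using Complex.tendsto_one_add_pow_exp_of_tendsto hlim

lemma norm_one_add_mul_I_mul_exp_neg_le (x : ℝ) :
    ‖(1 + x * Complex.I) * Complex.exp (-(x * Complex.I))‖ ≤ Real.exp (x ^ 2 / 2) := by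
  have h1 : ‖Complex.exp (-(x * Complex.I))‖ = 1 := by simp [Complex.norm_exp]
  have h2 : ‖1 + x * Complex.I‖ ^ 2 = 1 + x ^ 2 := by
    rw [← Complex.normSq_eq_norm_sq]
    simp [Complex.normSq_apply]
    ring
  rw [norm_mul, h1, mul_one]
  refine (sq_le_sq₀ (norm_nonneg _) (Real.exp_pos _).le).1 ?_
  rw [h2, ← Real.exp_nat_mul]
  refine (add_comm _ _).trans_le ((Real.add_one_le_exp _).trans_eq ?_)
  congr 1
  push_cast
  ring

/-- The rescaled Gaussian integrand through the saddle point. -/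
noncomputable def saddleIntegrand (c : ℝ) (n : ℕ) (y : ℝ) : ℂ :=
  ((1 + c * y * Complex.I / (Real.sqrt n : ℝ)) *
    Complex.exp (-(c * y * Complex.I / (Real.sqrt n : ℝ)))) ^ n * Real.exp (-y ^ 2)

lemma norm_saddleIntegrand_le (c : ℝ) (n : ℕ) (y : ℝ) :
    ‖saddleIntegrand c n y‖ ≤ Real.exp (-(1 - c ^ 2 / 2) * y ^ 2) := by
  have h1 : (c * y * Complex.I / (Real.sqrt n : ℝ) : ℂ) =
      ((c * y / Real.sqrt n : ℝ) : ℂ) * Complex.I := by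
    push_cast
    ring
  have h2 : n * ((c * y / Real.sqrt n) ^ 2 / 2) ≤ (c * y) ^ 2 / 2 := by
    rw [div_pow, Real.sq_sqrt n.cast_nonneg]
    rcases n.eq_zero_or_pos with rfl | hn
    · simp
      positivity
    · have : (0 : ℝ) < n := by exact_mod_cast hn
      field_simp
      exact le_rfl
  rw [saddleIntegrand, norm_mul, norm_pow, Complex.norm_real,
    Real.norm_of_nonneg (Real.exp_pos _).le, h1]
  calc _ ≤ Real.exp ((c * y / Real.sqrt n) ^ 2 / 2) ^ n * Real.exp (-y ^ 2) := by
        gcongr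
        exact norm_one_add_mul_I_mul_exp_neg_le _
    _ = Real.exp (n * ((c * y / Real.sqrt n) ^ 2 / 2) + -y ^ 2) := by
        rw [← Real.exp_nat_mul, Real.exp_add]
    _ ≤ _ := Real.exp_le_exp.2 (by linarith)

lemma tendsto_integral_saddleIntegrand {c : ℝ} (hc : c ^ 2 < 2) :
    Filter.Tendsto (fun n : ℕ => ∫ y, saddleIntegrand c n y) Filter.atTop
      (nhds (Real.sqrt (Real.pi / (1 - c ^ 2 / 2)) : ℝ)) := by
  rw [← integral_gaussian, ← integral_complex_ofReal]
  refine MeasureTheory.tendsto_integral_of_dominated_convergence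
    (fun y => Real.exp (-(1 - c ^ 2 / 2) * y ^ 2)) (fun n => ?_)
    (integrable_exp_neg_mul_sq (by linarith))
    (fun n => Filter.Eventually.of_forall (norm_saddleIntegrand_le c n))
    (Filter.Eventually.of_forall fun y => ?_)
  · refine Continuous.aestronglyMeasurable ?_
    unfold saddleIntegrand
    fun_prop
  · have h := (tendsto_one_add_div_sqrt_mul_exp_neg_pow (c * y * Complex.I)).mul_const
      (Real.exp (-y ^ 2) : ℂ)
    have h1 : Complex.exp (-(c * y * Complex.I) ^ 2 / 2) * (Real.exp (-y ^ 2) : ℂ) =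
        (Real.exp (-(1 - c ^ 2 / 2) * y ^ 2) : ℝ) := by
      rw [Complex.ofReal_exp, Complex.ofReal_exp, ← Complex.exp_add]
      congr 1
      push_cast
      rw [mul_pow, Complex.I_sq]
      ring
    rwa [h1] at h

lemma hermiteIntegrand_eq_mul_saddleIntegrand {c : ℝ} (hc : c ≠ 0) {n : ℕ} (hn : n ≠ 0) (y : ℝ) :
    hermiteIntegrand (Real.sqrt n / c) (Real.sqrt n * c / 2) n y =
      ((2 * (Real.sqrt n / c)) ^ n * Real.exp ((Real.sqrt n * c / 2) ^ 2) : ℝ) *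
        saddleIntegrand c n y := by
  have hs : Real.sqrt n ≠ 0 := by positivity
  have hsC : (Real.sqrt n : ℂ) ≠ 0 := by exact_mod_cast hs
  have hcC : (c : ℂ) ≠ 0 := by exact_mod_cast hc
  have hsq : (n : ℂ) = (Real.sqrt n : ℂ) ^ 2 := by
    exact_mod_cast congrArg Complex.ofReal (Real.sq_sqrt n.cast_nonneg).symm
  have h1 : (2 * (((Real.sqrt n / c : ℝ) : ℂ) + y * Complex.I)) =
      2 * (Real.sqrt n / c) * (1 + c * y * Complex.I / (Real.sqrt n : ℝ)) := by
    push_cast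
    field_simp
  have h2 : Complex.exp (-(y + ((Real.sqrt n * c / 2 : ℝ) : ℂ) * Complex.I) ^ 2) =
      Complex.exp ((Real.sqrt n * c / 2) ^ 2) *
        (Complex.exp (-(c * y * Complex.I / (Real.sqrt n : ℝ))) ^ n * Complex.exp (-y ^ 2)) := by
    rw [← Complex.exp_nat_mul, ← Complex.exp_add, ← Complex.exp_add, hsq]
    congr 1
    push_cast
    field_simp
    linear_combination (-(Real.sqrt n * c) ^ 2) * Complex.I_sq
  rw [hermiteIntegrand, saddleIntegrand, h1, h2, mul_pow (2 * _), mul_pow (1 + _)]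
  generalize (1 + c * y * Complex.I / (Real.sqrt n : ℝ) : ℂ) = q
  push_cast
  ring

lemma hermite_eq_integral_saddleIntegrand {c : ℝ} (hc : c ≠ 0) {n : ℕ} (hn : n ≠ 0) :
    hermite n (Real.sqrt n / c + Real.sqrt n * c / 2) =
      (2 * (Real.sqrt n / c)) ^ n * Real.exp ((Real.sqrt n * c / 2) ^ 2) *
        ((∫ y, saddleIntegrand c n y).re / Real.sqrt Real.pi) := by
  have h := integral_hermiteIntegrand (Real.sqrt n / c) (Real.sqrt n * c / 2) n
  simp only [hermiteIntegrand_eq_mul_saddleIntegrand hc hn] at h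
  rw [MeasureTheory.integral_const_mul] at h
  have h' := congrArg Complex.re h
  rw [Complex.re_ofReal_mul, Complex.ofReal_re] at h'
  have : Real.sqrt Real.pi ≠ 0 := by positivity
  rw [← mul_div_assoc, eq_div_iff this]
  linear_combination -h'

/-- Along the ray `ξ_n = t√(2n)` with fixed `t > 1`, the Hermite polynomial satisfies
the outer-region asymptotics `H_n(ξ_n) ∼ Λ₂(n) = exp(Φ₂(ξ_n)) U₂(ξ_n)` with
`σ_n = √(ξ_n² - 2n)`, `Φ₂(ξ) = n ln(σ + ξ) + (ξ² - σξ - n)/2`, `U₂(ξ) = √((1 + ξ/σ)/2)`;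
that is, `H_n(ξ_n)/Λ₂(n) → 1` as `n → ∞`. -/
theorem hermite_outer_asymptotics (t : ℝ) (ht : 1 < t) :
    Filter.Tendsto
      (fun n : ℕ =>
        let ξ : ℝ := t * Real.sqrt (2 * n)
        let σ : ℝ := Real.sqrt (ξ ^ 2 - 2 * n)
        hermite n ξ /
          (Real.exp ((n : ℝ) * Real.log (σ + ξ) + (ξ ^ 2 - σ * ξ - n) / 2) *
            Real.sqrt ((1 + ξ / σ) / 2)))
      Filter.atTop (nhds 1) := by
  set s := Real.sqrt (t ^ 2 - 1) with hs
  have hs_sq : s ^ 2 = t ^ 2 - 1 := Real.sq_sqrt (by nlinarith)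
  have hs_pos : 0 < s := Real.sqrt_pos.2 (by nlinarith)
  have hts : 0 < t + s := by linarith
  have h2 : Real.sqrt 2 ^ 2 = 2 := Real.sq_sqrt (by norm_num)
  have h2_pos : 0 < Real.sqrt 2 := by positivity
  set c := Real.sqrt 2 / (t + s) with hc
  have hc_pos : 0 < c := by positivity
  have hc_sq : 1 - c ^ 2 / 2 = 2 * s / (t + s) := by
    rw [hc, div_pow, h2]
    field_simp
    linear_combination -hs_sq
  have hc_lt : c ^ 2 < 2 := by
    have : 0 < 2 * s / (t + s) := by positivity
    linarith
  have hU : (1 + t / s) / 2 = 1 / (1 - c ^ 2 / 2) := by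
    rw [hc_sq]
    field_simp
    ring
  have hU_pos : 0 < Real.sqrt (1 / (1 - c ^ 2 / 2)) := Real.sqrt_pos.2 (by rw [hc_sq]; positivity)
  have hpi : 0 < Real.sqrt Real.pi := by positivity
  have hlim : Filter.Tendsto (fun n : ℕ => (∫ y, saddleIntegrand c n y).re / Real.sqrt Real.pi /
      Real.sqrt (1 / (1 - c ^ 2 / 2))) Filter.atTop (nhds 1) := by
    have h := ((Complex.continuous_re.tendsto _).comp
      (tendsto_integral_saddleIntegrand hc_lt)).div_const (Real.sqrt Real.pi) |>.div_const
        (Real.sqrt (1 / (1 - c ^ 2 / 2)))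
    have hone : Real.sqrt (Real.pi / (1 - c ^ 2 / 2)) / Real.sqrt Real.pi /
        Real.sqrt (1 / (1 - c ^ 2 / 2)) = 1 := by
      rw [div_eq_mul_one_div Real.pi, Real.sqrt_mul Real.pi_pos.le, mul_div_cancel_left₀ _ hpi.ne',
        div_self hU_pos.ne']
    rwa [Complex.ofReal_re, hone] at h
  refine hlim.congr' ?_
  filter_upwards [Filter.eventually_ne_atTop 0] with n hn
  have hn_pos : 0 < Real.sqrt n := by positivity
  have hn_sq : Real.sqrt n ^ 2 = n := Real.sq_sqrt n.cast_nonneg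
  have hξ : t * Real.sqrt (2 * n) = Real.sqrt n / c + Real.sqrt n * c / 2 := by
    rw [Real.sqrt_mul (by norm_num), hc]
    field_simp
    rw [h2]
    linear_combination -2 * hs_sq
  have hσ : Real.sqrt ((t * Real.sqrt (2 * n)) ^ 2 - 2 * n) = s * Real.sqrt (2 * n) := by
    rw [mul_pow, Real.sq_sqrt (by positivity), hs, ← Real.sqrt_mul (by nlinarith)]
    ring_nf
  have hσ' : s * Real.sqrt (2 * n) = Real.sqrt n / c - Real.sqrt n * c / 2 := by
    rw [Real.sqrt_mul (by norm_num), hc]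
    field_simp
    rw [h2]
    linear_combination 2 * hs_sq
  have hratio : t * Real.sqrt (2 * n) / (s * Real.sqrt (2 * n)) = t / s :=
    mul_div_mul_right _ _ (by positivity)
  have hlog : Real.exp (n * Real.log (s * Real.sqrt (2 * n) + t * Real.sqrt (2 * n)) +
      ((t * Real.sqrt (2 * n)) ^ 2 - s * Real.sqrt (2 * n) * (t * Real.sqrt (2 * n)) - n) / 2) =
      (2 * (Real.sqrt n / c)) ^ n * Real.exp ((Real.sqrt n * c / 2) ^ 2) := by
    rw [hσ', hξ, Real.exp_add, Real.exp_nat_mul, Real.exp_log (by ring_nf; positivity)]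
    congr 2
    · ring
    · have hcc : Real.sqrt n / c * c = Real.sqrt n := div_mul_cancel₀ _ hc_pos.ne'
      linear_combination (1 / 2) * hn_sq + Real.sqrt n / 2 * hcc
  simp only [hσ, hratio, hU, hlog]
  rw [hξ, hermite_eq_integral_saddleIntegrand hc_pos.ne' hn]
  have : (2 * (Real.sqrt n / c)) ^ n * Real.exp ((Real.sqrt n * c / 2) ^ 2) ≠ 0 := by positivity
  rw [mul_div_mul_left _ _ this]
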